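/- arXiv:1404.4481 — 8 statements merged into one kernel-verified Lean document; each statement's English description precedes it below -/
import Mathlib

section
/- Let 0 < ω₀ < π and b ∈ ℝ. A nonzero number λ ∈ ℂ is an eigenvalue of the model nonlocal eigenvalue problem if and only if (e^{−λω₀} − e^{λω₀})·(e^{λω₀} + e^{−λω₀} + b) = 0. -/
open Set Complex

/-- `φ` is twice continuously differentiable on `[-ω₀, ω₀]`, with first derivative `φ'`
and second derivative `φ''` (derivatives in the sense of `HasDerivWithinAt`). -/
def C2On (ω₀ : ℝ) (φ φ' φ'' : ℝ → ℂ) : Prop :=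
  (∀ ω ∈ Icc (-ω₀) ω₀, HasDerivWithinAt φ (φ' ω) (Icc (-ω₀) ω₀) ω) ∧
  (∀ ω ∈ Icc (-ω₀) ω₀, HasDerivWithinAt φ' (φ'' ω) (Icc (-ω₀) ω₀) ω) ∧
  ContinuousOn φ'' (Icc (-ω₀) ω₀)

/-- The nonlocal conditions `φ(-ω₀) = 0` and `φ(ω₀) + b·φ(0) = 0`. -/
def NonlocalBC (ω₀ b : ℝ) (φ : ℝ → ℂ) : Prop :=
  φ (-ω₀) = 0 ∧ φ ω₀ + (b : ℂ) * φ 0 = 0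

/-- `φ` is a (possibly zero) solution of the model nonlocal eigenvalue problem for `λ`:
`φ` is twice continuously differentiable on `[-ω₀, ω₀]`, `φ'' = λ²·φ` there, and the
nonlocal conditions hold. -/
def IsSolution (ω₀ b : ℝ) (lam : ℂ) (φ : ℝ → ℂ) : Prop :=
  (∃ φ' φ'', C2On ω₀ φ φ' φ'' ∧ ∀ ω ∈ Icc (-ω₀) ω₀, φ'' ω = lam ^ 2 * φ ω) ∧
  NonlocalBC ω₀ b φ

/-- `φ` is an eigenvector: a solution not identically zero on `[-ω₀, ω₀]`. -/
def IsEigenvector (ω₀ b : ℝ) (lam : ℂ) (φ : ℝ → ℂ) : Prop :=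
  IsSolution ω₀ b lam φ ∧ ∃ ω ∈ Icc (-ω₀) ω₀, φ ω ≠ 0

/-- `λ` is an eigenvalue of the model nonlocal eigenvalue problem. -/
def IsEigenvalue (ω₀ b : ℝ) (lam : ℂ) : Prop :=
  ∃ φ : ℝ → ℂ, IsEigenvector ω₀ b lam φ

/-- `ψ` is twice continuously differentiable on `[-ω₀, ω₀]`, solves
`ψ'' - λ²·ψ - f = 0` there, and satisfies the nonlocal conditions. -/
def IsAssociatedSol (ω₀ b : ℝ) (lam : ℂ) (f : ℝ → ℂ) (ψ : ℝ → ℂ) : Prop :=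
  (∃ ψ' ψ'', C2On ω₀ ψ ψ' ψ'' ∧
      ∀ ω ∈ Icc (-ω₀) ω₀, ψ'' ω - lam ^ 2 * ψ ω - f ω = 0) ∧
  NonlocalBC ω₀ b ψ

/-- `(φ0, φ1)` is a Jordan chain of length 2 at `λ`. -/
def IsJordanChain2 (ω₀ b : ℝ) (lam : ℂ) (φ0 φ1 : ℝ → ℂ) : Prop :=
  IsEigenvector ω₀ b lam φ0 ∧
  IsAssociatedSol ω₀ b lam (fun ω => 2 * lam * φ0 ω) φ1

/-- `(φ0, φ1, φ2)` is a Jordan chain of length 3 at `λ`. -/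
def IsJordanChain3 (ω₀ b : ℝ) (lam : ℂ) (φ0 φ1 φ2 : ℝ → ℂ) : Prop :=
  IsEigenvector ω₀ b lam φ0 ∧
  IsAssociatedSol ω₀ b lam (fun ω => 2 * lam * φ0 ω) φ1 ∧
  IsAssociatedSol ω₀ b lam (fun ω => 2 * lam * φ1 ω + φ0 ω) φ2

theorem hasDerivAt_cexp_mul_ofReal (a : ℂ) (x : ℝ) :
    HasDerivAt (fun t : ℝ => Complex.exp (a * t)) (a * Complex.exp (a * x)) x := by
  have h := (((hasDerivAt_id (x : ℂ)).const_mul a).cexp).comp_ofReal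
  simpa [mul_comm] using h

/-- If `u' = a·u` on `[-ω₀, ω₀]`, then `u` is a multiple of `e^{aω}`. -/
theorem exists_eq_const_mul_cexp {ω₀ : ℝ} {a : ℂ} {u : ℝ → ℂ}
    (hu : ∀ ω ∈ Icc (-ω₀) ω₀, HasDerivWithinAt u (a * u ω) (Icc (-ω₀) ω₀) ω) :
    ∃ c : ℂ, ∀ ω ∈ Icc (-ω₀) ω₀, u ω = c * Complex.exp (a * ω) := by
  rcases lt_or_ge ω₀ (-ω₀) with hneg | hle
  · exact ⟨0, fun ω hω => absurd (hω.1.trans hω.2) (not_le.mpr hneg)⟩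
  have hderiv : ∀ ω ∈ Icc (-ω₀) ω₀,
      HasDerivWithinAt (fun t : ℝ => u t * Complex.exp (-a * t)) 0 (Icc (-ω₀) ω₀) ω := by
    intro ω hω
    refine ((hu ω hω).mul (hasDerivAt_cexp_mul_ofReal (-a) ω).hasDerivWithinAt).congr_deriv ?_
    ring
  have hconst := constant_of_derivWithin_zero (a := -ω₀) (b := ω₀)
    (fun ω hω => (hderiv ω hω).differentiableWithinAt) fun ω hω => by
      have hω' := Ico_subset_Icc_self hω
      exact (hderiv ω hω').derivWithin
        (uniqueDiffOn_Icc (hω.1.trans_lt hω.2) ω hω')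
  refine ⟨u (-ω₀) * Complex.exp (-a * (-ω₀ : ℝ)), fun ω hω => ?_⟩
  rw [← hconst ω hω, mul_assoc, ← Complex.exp_add]
  simp

/-- A solution of `φ'' = λ²·φ` is a combination of `e^{λω}` and `e^{-λω}`. -/
theorem C2On.exists_exp_combination {ω₀ : ℝ} {lam : ℂ} {φ φ' φ'' : ℝ → ℂ}
    (h : C2On ω₀ φ φ' φ'') (heq : ∀ ω ∈ Icc (-ω₀) ω₀, φ'' ω = lam ^ 2 * φ ω) :
    ∃ c d : ℂ, ∀ ω ∈ Icc (-ω₀) ω₀,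
      2 * lam * φ ω = c * Complex.exp (lam * ω) + d * Complex.exp (-lam * ω) := by
  obtain ⟨c, hc⟩ := exists_eq_const_mul_cexp (a := lam) (u := fun t => φ' t + lam * φ t)
    fun ω hω => ((h.2.1 ω hω).add ((h.1 ω hω).const_mul lam)).congr_deriv (by
      rw [heq ω hω]; ring)
  obtain ⟨d, hd⟩ := exists_eq_const_mul_cexp (a := -lam) (u := fun t => lam * φ t - φ' t)
    fun ω hω => (((h.1 ω hω).const_mul lam).sub (h.2.1 ω hω)).congr_deriv (by
      rw [heq ω hω]; ring)
  exact ⟨c, d, fun ω hω => by linear_combination hc ω hω + hd ω hω⟩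

/-- A nonzero `λ ∈ ℂ` is an eigenvalue of the model nonlocal eigenvalue problem if and only
if `(e^{-λω₀} - e^{λω₀})·(e^{λω₀} + e^{-λω₀} + b) = 0`. -/
theorem statement2 (ω₀ b : ℝ) (hω₀ : 0 < ω₀) (hω₀' : ω₀ < Real.pi)
    (lam : ℂ) (hlam : lam ≠ 0) :
    IsEigenvalue ω₀ b lam ↔
      (Complex.exp (-lam * ω₀) - Complex.exp (lam * ω₀)) *
        (Complex.exp (lam * ω₀) + Complex.exp (-lam * ω₀) + (b : ℂ)) = 0 := by
  have hleft : -ω₀ ∈ Icc (-ω₀) ω₀ := ⟨le_rfl, by linarith⟩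
  have hzero : (0 : ℝ) ∈ Icc (-ω₀) ω₀ := ⟨by linarith, hω₀.le⟩
  have hright : ω₀ ∈ Icc (-ω₀) ω₀ := ⟨by linarith, le_rfl⟩
  constructor
  · rintro ⟨φ, ⟨⟨φ', φ'', hC2, heq⟩, hbc₁, hbc₂⟩, ω, hω, hne⟩
    by_contra hdet
    obtain ⟨c, d, hcd⟩ := hC2.exists_exp_combination heq
    have h₁ := hcd _ hleft
    have h₀ := hcd _ hzero
    have h₂ := hcd _ hright
    simp only [ofReal_neg, mul_neg, neg_mul, neg_neg, ofReal_zero, mul_zero,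
      Complex.exp_zero, hbc₁] at h₀ h₁ h₂ hdet
    have hc : c = 0 := (mul_eq_zero.mp (b := _) (by
      linear_combination (-(Complex.exp (-(lam * ω₀)) + b)) * h₁ + Complex.exp (lam * ω₀) * (h₂ +
        b * h₀ - 2 * lam * hbc₂))).resolve_right hdet
    have hd : d = 0 := (mul_eq_zero.mp (b := _) (by
      linear_combination (Complex.exp (lam * ω₀) + b) * h₁ - Complex.exp (-(lam * ω₀)) * (h₂ +
        b * h₀ - 2 * lam * hbc₂))).resolve_right hdet
    have h := hcd ω hω
    simp [hc, hd, hlam, hne] at h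
  · intro hdet
    let φ : ℝ → ℂ := fun t =>
      Complex.exp (lam * ω₀) * Complex.exp (lam * t) -
        Complex.exp (-lam * ω₀) * Complex.exp (-lam * t)
    let φ' : ℝ → ℂ := fun t =>
      lam * (Complex.exp (lam * ω₀) * Complex.exp (lam * t) +
        Complex.exp (-lam * ω₀) * Complex.exp (-lam * t))
    have hφ : ∀ t, HasDerivAt φ (φ' t) t := fun t =>
      (((hasDerivAt_cexp_mul_ofReal lam t).const_mul _).sub
        ((hasDerivAt_cexp_mul_ofReal (-lam) t).const_mul _)).congr_deriv (by
          simp only [φ']; ring)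
    have hφ' : ∀ t, HasDerivAt φ' (lam ^ 2 * φ t) t := fun t =>
      ((((hasDerivAt_cexp_mul_ofReal lam t).const_mul _).add
        ((hasDerivAt_cexp_mul_ofReal (-lam) t).const_mul _)).const_mul lam).congr_deriv (by
          simp only [φ]; ring)
    have hcont : Continuous φ := continuous_iff_continuousAt.mpr fun t => (hφ t).continuousAt
    refine ⟨φ, ⟨⟨φ', fun t => lam ^ 2 * φ t, ⟨fun t _ => (hφ t).hasDerivWithinAt,
      fun t _ => (hφ' t).hasDerivWithinAt, (hcont.const_mul _).continuousOn⟩, fun _ _ => rfl⟩,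
      ?_, ?_⟩, ?_⟩
    · simp [φ, mul_comm]
    · simp only [φ, ofReal_zero, mul_zero, Complex.exp_zero]
      linear_combination -hdet
    · by_contra! hall
      have hd₀ : HasDerivWithinAt φ 0 (Icc (-ω₀) ω₀) (-ω₀) :=
        (hasDerivWithinAt_const (-ω₀) _ (0 : ℂ)).congr hall (hall _ hleft)
      have h := (uniqueDiffOn_Icc (by linarith : -ω₀ < ω₀) _ hleft).eq_deriv _
        (hφ (-ω₀)).hasDerivWithinAt hd₀
      simp [φ', hlam, ← Complex.exp_add] at h
end

section
/- Let 0 < ω₀ < π, b ∈ ℝ, k a nonzero integer, λ_{1k} = i·πk/ω₀, and φ_{1k}(ω) = exp(i·πk·ω/ω₀) − exp(−i·πk·ω/ω₀). Then there exists a twice continuously differentiable function ψ : [−ω₀, ω₀] → ℂ with ψ''(ω) − λ_{1k}²·ψ(ω) − 2λ_{1k}·φ_{1k}(ω) = 0 on [−ω₀, ω₀], ψ(−ω₀) = 0 and ψ(ω₀) + b·ψ(0) = 0 (an associated vector to the eigenvector φ_{1k}) if and only if b = 2·(−1)^{k+1}. -/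
open Set Complex

/-- A function with vanishing derivative on `[-ω₀, ω₀]` takes its value at `0` throughout. -/
lemma eq_zero_value_of_hasDerivWithinAt_zero {ω₀ : ℝ} (hω₀ : 0 < ω₀) {f f' : ℝ → ℂ}
    (hf : ∀ ω ∈ Icc (-ω₀) ω₀, HasDerivWithinAt f (f' ω) (Icc (-ω₀) ω₀) ω)
    (hf' : ∀ ω ∈ Icc (-ω₀) ω₀, f' ω = 0) :
    ∀ ω ∈ Icc (-ω₀) ω₀, f ω = f 0 := by
  intro ω hω
  have h := (convex_Icc (-ω₀) ω₀).norm_image_sub_le_of_norm_hasDerivWithin_le (C := 0) hf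
    (fun x hx => by simp [hf' x hx]) (⟨by linarith, hω₀.le⟩ : (0 : ℝ) ∈ Icc (-ω₀) ω₀) hω
  rw [zero_mul] at h
  exact sub_eq_zero.mp (norm_le_zero_iff.mp h)

lemma hasDerivAt_exp_mul_ofReal (L : ℂ) (ω : ℝ) :
    HasDerivAt (fun x : ℝ => exp (L * x)) (L * exp (L * ω)) ω := by
  have h := ((hasDerivAt_id (ω : ℂ)).const_mul L).cexp.comp_ofReal
  simpa [mul_comm] using h

/-- Solutions of `φ'' = L²·φ` are combinations of exponentials. -/
lemma C2On.two_mul_eq_exp_add_exp {ω₀ : ℝ} (hω₀ : 0 < ω₀) {L : ℂ} {φ φ' φ'' : ℝ → ℂ}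
    (h : C2On ω₀ φ φ' φ'') (hode : ∀ ω ∈ Icc (-ω₀) ω₀, φ'' ω = L ^ 2 * φ ω) :
    ∀ ω ∈ Icc (-ω₀) ω₀, 2 * L * φ ω =
      (φ' 0 + L * φ 0) * exp (L * ω) - (φ' 0 - L * φ 0) * exp (-L * ω) := by
  have key : ∀ M : ℂ, M ^ 2 = L ^ 2 → ∀ ω ∈ Icc (-ω₀) ω₀,
      (φ' ω + M * φ ω) * exp (-M * ω) = φ' 0 + M * φ 0 := by
    intro M hM ω hω
    have := eq_zero_value_of_hasDerivWithinAt_zero hω₀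
      (fun x hx => ((h.2.1 x hx).add ((h.1 x hx).const_mul M)).mul
        (hasDerivAt_exp_mul_ofReal (-M) x).hasDerivWithinAt)
      (fun x hx => by
        simp only [Pi.add_apply, hode x hx]
        linear_combination -(φ x * exp (-M * x)) * hM) ω hω
    simpa using this
  intro ω hω
  have h₁ := key L rfl ω hω
  have h₂ := key (-L) (by ring) ω hω
  have he : exp (L * ω) * exp (-L * ω) = 1 := by
    rw [← Complex.exp_add]; simp
  rw [neg_neg] at h₂
  linear_combination exp (L * ω) * h₁ - exp (-L * ω) * h₂ - (2 * L * φ ω) * he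

/-- The resonant particular solution `ω·(exp (Lω) + exp (-Lω))` plus a multiple of
`exp (Lω)`. -/
lemma resonant_C2On (ω₀ : ℝ) (L a : ℂ) :
    C2On ω₀ (fun ω => ω * (exp (L * ω) + exp (-L * ω)) + a * exp (L * ω))
      (fun ω => exp (L * ω) + exp (-L * ω) + ω * (L * exp (L * ω) - L * exp (-L * ω))
        + a * (L * exp (L * ω)))
      (fun ω => 2 * (L * exp (L * ω) - L * exp (-L * ω))
        + ω * (L ^ 2 * exp (L * ω) + L ^ 2 * exp (-L * ω)) + a * (L ^ 2 * exp (L * ω))) := by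
  refine ⟨fun ω _ => ?_, fun ω _ => ?_, by fun_prop⟩
  all_goals
    have h₁ := hasDerivAt_exp_mul_ofReal L ω
    have h₂ := hasDerivAt_exp_mul_ofReal (-L) ω
    have h₀ : HasDerivAt (fun x : ℝ => (x : ℂ)) 1 ω := Complex.ofRealCLM.hasDerivAt
  · refine (((h₀.mul (h₁.add h₂)).add (h₁.const_mul a)).congr_deriv ?_).hasDerivWithinAt
    simp only [Pi.add_apply]
    ring
  · refine ((((h₁.add h₂).add (h₀.mul ((h₁.const_mul L).sub (h₂.const_mul L)))).add
      ((h₁.const_mul L).const_mul a)).congr_deriv ?_).hasDerivWithinAt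
    simp only [Pi.sub_apply]
    ring

lemma C2On.sub {ω₀ : ℝ} {φ φ' φ'' ψ ψ' ψ'' : ℝ → ℂ} (hφ : C2On ω₀ φ φ' φ'')
    (hψ : C2On ω₀ ψ ψ' ψ'') : C2On ω₀ (φ - ψ) (φ' - ψ') (φ'' - ψ'') :=
  ⟨fun ω hω => (hφ.1 ω hω).sub (hψ.1 ω hω), fun ω hω => (hφ.2.1 ω hω).sub (hψ.2.1 ω hω),
    hφ.2.2.sub hψ.2.2⟩

/-- When `exp (Lω₀) = exp (-Lω₀) = s` with `s² = 1`, the resonant problem is solvable exactly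
for `b = -2s`. -/
lemma exists_isAssociatedSol_iff {ω₀ b : ℝ} (hω₀ : 0 < ω₀) {L s : ℂ} (hL : L ≠ 0)
    (hs : s ^ 2 = 1) (h₁ : exp (L * ω₀) = s) (h₂ : exp (-L * ω₀) = s) :
    (∃ ψ, IsAssociatedSol ω₀ b L (fun ω => 2 * L * (exp (L * ω) - exp (-L * ω))) ψ) ↔
      (b : ℂ) = -2 * s := by
  have hω₀C : (ω₀ : ℂ) ≠ 0 := by exact_mod_cast hω₀.ne'
  have h₃ : exp (L * ((-ω₀ : ℝ) : ℂ)) = s := by rw [← h₂]; push_cast; ring_nf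
  have h₄ : exp (-L * ((-ω₀ : ℝ) : ℂ)) = s := by rw [← h₁]; push_cast; ring_nf
  constructor
  · rintro ⟨ψ, ⟨ψ', ψ'', hC, hode⟩, hbc₁, hbc₂⟩
    have hsol := (hC.sub (resonant_C2On ω₀ L 0)).two_mul_eq_exp_add_exp hω₀ (L := L)
      (fun ω hω => by
        simp only [Pi.sub_apply]
        linear_combination hode ω hω)
    have hneg := hsol (-ω₀) ⟨le_rfl, by linarith⟩
    have hpos := hsol ω₀ ⟨by linarith, le_rfl⟩
    simp only [Pi.sub_apply, h₁, h₂, h₃, h₄, hbc₁, ofReal_zero, mul_zero, Complex.exp_zero,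
      zero_mul, add_zero, sub_zero] at hneg hpos
    rw [ofReal_neg] at hneg
    have hψ₀ : ψ 0 = 2 * ω₀ := by
      refine mul_left_cancel₀ (mul_ne_zero two_ne_zero hL) ?_
      linear_combination (-s) * hneg - (2 * L * ψ 0 - 4 * L * ω₀) * hs
    have hψ₁ : ψ ω₀ = 4 * ω₀ * s := by
      refine mul_left_cancel₀ (mul_ne_zero two_ne_zero hL) ?_
      linear_combination hpos - hneg
    refine mul_left_cancel₀ (mul_ne_zero two_ne_zero hω₀C) ?_
    linear_combination hbc₂ - hψ₁ - b * hψ₀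
  · intro hb
    refine ⟨_, ⟨_, _, resonant_C2On ω₀ L (2 * ω₀), fun ω _ => by ring⟩, ?_, ?_⟩
    · simp only [h₃, h₄]
      push_cast
      ring
    · simp only [h₁, h₂, hb, ofReal_zero, mul_zero, Complex.exp_zero]
      ring

lemma exp_int_mul_pi_mul_I (k : ℤ) : exp (k * (Real.pi * I)) = (-1) ^ k := by
  rw [Complex.exp_int_mul, Complex.exp_pi_mul_I]

/-- An associated vector to the eigenvector `φ_{1k}` at `λ_{1k} = i·πk/ω₀` exists if and
only if `b = 2·(-1)^{k+1}`. -/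
theorem statement4 (ω₀ b : ℝ) (hω₀ : 0 < ω₀) (hω₀' : ω₀ < Real.pi)
    (k : ℤ) (hk : k ≠ 0) :
    (∃ ψ : ℝ → ℂ, IsAssociatedSol ω₀ b (Complex.I * (Real.pi * k) / ω₀)
        (fun ω => 2 * (Complex.I * (Real.pi * k) / ω₀) *
          (Complex.exp (Complex.I * (Real.pi * k) * ω / ω₀) -
            Complex.exp (-(Complex.I * (Real.pi * k) * ω) / ω₀))) ψ) ↔
      b = 2 * (-1 : ℝ) ^ (k + 1) := by
  have hω₀C : (ω₀ : ℂ) ≠ 0 := by exact_mod_cast hω₀.ne'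
  have hL : Complex.I * (Real.pi * k) / (ω₀ : ℂ) ≠ 0 := by
    simp [Real.pi_ne_zero, hk, hω₀.ne']
  have h₁ : exp (Complex.I * (Real.pi * k) / ω₀ * ω₀) = (-1) ^ k := by
    rw [div_mul_cancel₀ _ hω₀C, ← exp_int_mul_pi_mul_I]
    ring_nf
  have h₂ : exp (-(Complex.I * (Real.pi * k) / ω₀) * ω₀) = (-1) ^ k := by
    rw [neg_mul, Complex.exp_neg, h₁, ← inv_zpow, inv_neg_one]
  have hs : ((-1 : ℂ) ^ k) ^ 2 = 1 := by
    rw [← zpow_natCast, zpow_comm]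
    simp
  have hmain := exists_isAssociatedSol_iff (b := b) hω₀ hL hs h₁ h₂
  have hf : (fun ω : ℝ => 2 * (Complex.I * (Real.pi * k) / ω₀) *
      (exp (Complex.I * (Real.pi * k) * ω / ω₀) -
        exp (-(Complex.I * (Real.pi * k) * ω) / ω₀))) =
      fun ω : ℝ => 2 * (Complex.I * (Real.pi * k) / ω₀) *
        (exp (Complex.I * (Real.pi * k) / ω₀ * ω) -
          exp (-(Complex.I * (Real.pi * k) / ω₀) * ω)) := by
    ext ω
    congr 3 <;> ring
  rw [hf, hmain, zpow_add_one₀ (by norm_num), ← Complex.ofReal_inj]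
  push_cast
  ring_nf
end

section
/- Let 0 < ω₀ < π, k a nonzero integer, b = 2·(−1)^{k+1}, and λ = i·πk/ω₀. Then the three functions φ⁽⁰⁾(ω) = exp(i·πk·ω/ω₀) − exp(−i·πk·ω/ω₀), φ⁽¹⁾(ω) = (ω + 2ω₀)·exp(i·πk·ω/ω₀) + ω·exp(−i·πk·ω/ω₀), and φ⁽²⁾(ω) = (ω²/2 + 2ω₀·ω + 2ω₀²)·exp(i·πk·ω/ω₀) − (ω²/2)·exp(−i·πk·ω/ω₀) form a Jordan chain of length 3 at λ for the model nonlocal eigenvalue problem. -/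
open Set Complex

/-- The function `(c₀ + c₁ω + c₂ω²) exp(λω) + (d₀ + d₁ω + d₂ω²) exp(-λω)`. -/
noncomputable def quasiPoly (lam c₀ c₁ c₂ d₀ d₁ d₂ : ℂ) (ω : ℝ) : ℂ :=
  (c₀ + c₁ * ω + c₂ * (ω : ℂ) ^ 2) * exp (lam * ω) +
    (d₀ + d₁ * ω + d₂ * (ω : ℂ) ^ 2) * exp (-(lam * ω))

theorem hasDerivAt_quasiPoly (lam c₀ c₁ c₂ d₀ d₁ d₂ : ℂ) (ω : ℝ) :
    HasDerivAt (quasiPoly lam c₀ c₁ c₂ d₀ d₁ d₂)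
      (quasiPoly lam (lam * c₀ + c₁) (lam * c₁ + 2 * c₂) (lam * c₂)
        (-lam * d₀ + d₁) (-lam * d₁ + 2 * d₂) (-lam * d₂) ω) ω := by
  have hid : HasDerivAt (fun x : ℝ => (x : ℂ)) 1 ω := ofRealCLM.hasDerivAt
  have hpoly (a₀ a₁ a₂ : ℂ) : HasDerivAt (fun x : ℝ => a₀ + a₁ * (x : ℂ) + a₂ * (x : ℂ) ^ 2)
      (a₁ * 1 + a₂ * ((2 : ℕ) * (ω : ℂ) ^ (2 - 1) * 1)) ω :=
    ((hid.const_mul a₁).const_add a₀).add ((hid.pow 2).const_mul a₂)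
  have hlin := hid.const_mul lam
  refine (((hpoly c₀ c₁ c₂).mul hlin.cexp).add
    ((hpoly d₀ d₁ d₂).mul hlin.neg.cexp)).congr_deriv ?_
  simp only [quasiPoly]
  push_cast [Pi.neg_apply]
  ring

theorem exists_c2On_quasiPoly (ω₀ lam c₀ c₁ c₂ d₀ d₁ d₂) :
    ∃ φ' φ'', C2On ω₀ (quasiPoly lam c₀ c₁ c₂ d₀ d₁ d₂) φ' φ'' ∧
      ∀ ω, φ'' ω = lam ^ 2 * quasiPoly lam c₀ c₁ c₂ d₀ d₁ d₂ ω +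
        quasiPoly lam (2 * lam * c₁ + 2 * c₂) (4 * lam * c₂) 0
          (-2 * lam * d₁ + 2 * d₂) (-4 * lam * d₂) 0 ω := by
  refine ⟨_, _, ⟨fun ω _ => (hasDerivAt_quasiPoly ..).hasDerivWithinAt,
    fun ω _ => (hasDerivAt_quasiPoly ..).hasDerivWithinAt,
    fun ω _ => (hasDerivAt_quasiPoly ..).continuousAt.continuousWithinAt⟩, fun ω => ?_⟩
  simp only [quasiPoly]
  ring

theorem exp_I_mul_pi_mul_int (k : ℤ) : exp (I * (Real.pi * k)) = (-1) ^ k := by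
  rw [← exp_pi_mul_I, ← exp_int_mul]
  ring_nf

theorem exp_neg_I_mul_pi_mul_int (k : ℤ) : exp (-(I * (Real.pi * k))) = (-1) ^ k := by
  rw [exp_neg, exp_I_mul_pi_mul_int, ← inv_zpow]
  norm_num

/-- The nonlocal conditions for a quasipolynomial with exponents `±iπk/ω₀`. -/
theorem nonlocalBC_quasiPoly {ω₀ : ℝ} (hω₀ : ω₀ ≠ 0) (k : ℤ) {c₀ c₁ c₂ d₀ d₁ d₂ : ℂ}
    (hleft : c₀ + d₀ - (c₁ + d₁) * ω₀ + (c₂ + d₂) * ω₀ ^ 2 = 0)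
    (hright : c₀ + d₀ + (c₁ + d₁) * ω₀ + (c₂ + d₂) * ω₀ ^ 2 = 2 * (c₀ + d₀)) :
    NonlocalBC ω₀ (2 * (-1 : ℝ) ^ (k + 1))
      (quasiPoly (I * (Real.pi * k) / ω₀) c₀ c₁ c₂ d₀ d₁ d₂) := by
  have hω : (ω₀ : ℂ) ≠ 0 := ofReal_ne_zero.mpr hω₀
  have hpow : (-1 : ℂ) ^ (k + 1) = -(-1) ^ k := by
    rw [zpow_add₀ (by norm_num)]
    simp
  constructor
  · simp only [quasiPoly, ofReal_neg, mul_neg, neg_neg, div_mul_cancel₀ _ hω,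
      exp_I_mul_pi_mul_int, exp_neg_I_mul_pi_mul_int]
    linear_combination (-1 : ℂ) ^ k * hleft
  · simp only [quasiPoly, div_mul_cancel₀ _ hω, exp_I_mul_pi_mul_int, exp_neg_I_mul_pi_mul_int,
      ofReal_mul, ofReal_zpow, ofReal_neg, ofReal_one, ofReal_ofNat, hpow, ofReal_zero, mul_zero,
      neg_zero, exp_zero]
    linear_combination (-1 : ℂ) ^ k * hright

/-- For `b = 2·(-1)^{k+1}` and `λ = i·πk/ω₀`, the functions `φ⁽⁰⁾, φ⁽¹⁾, φ⁽²⁾` form a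
Jordan chain of length 3 at `λ`. -/
theorem statement5 (ω₀ : ℝ) (hω₀ : 0 < ω₀) (hω₀' : ω₀ < Real.pi)
    (k : ℤ) (hk : k ≠ 0) :
    IsJordanChain3 ω₀ (2 * (-1 : ℝ) ^ (k + 1)) (Complex.I * (Real.pi * k) / ω₀)
      (fun ω => Complex.exp (Complex.I * (Real.pi * k) * ω / ω₀) -
        Complex.exp (-(Complex.I * (Real.pi * k) * ω) / ω₀))
      (fun ω => ((ω : ℂ) + 2 * (ω₀ : ℂ)) * Complex.exp (Complex.I * (Real.pi * k) * ω / ω₀) +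
        (ω : ℂ) * Complex.exp (-(Complex.I * (Real.pi * k) * ω) / ω₀))
      (fun ω => ((ω : ℂ) ^ 2 / 2 + 2 * (ω₀ : ℂ) * ω + 2 * (ω₀ : ℂ) ^ 2) *
          Complex.exp (Complex.I * (Real.pi * k) * ω / ω₀) -
        ((ω : ℂ) ^ 2 / 2) * Complex.exp (-(Complex.I * (Real.pi * k) * ω) / ω₀)) := by
  have hω : (ω₀ : ℂ) ≠ 0 := ofReal_ne_zero.mpr hω₀.ne'
  set lam : ℂ := I * (Real.pi * k) / ω₀ with hlam
  have harg (ω : ℝ) : I * (Real.pi * k) * ω / ω₀ = lam * ω := by rw [hlam]; ring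
  have harg' (ω : ℝ) : -(I * (Real.pi * k) * ω) / ω₀ = -(lam * ω) := by rw [hlam]; ring
  simp only [harg, harg']
  have h₀ : (fun ω : ℝ => exp (lam * ω) - exp (-(lam * ω))) = quasiPoly lam 1 0 0 (-1) 0 0 := by
    funext ω
    simp only [quasiPoly]
    ring
  have h₁ : (fun ω : ℝ => ((ω : ℂ) + 2 * ω₀) * exp (lam * ω) + ω * exp (-(lam * ω))) =
      quasiPoly lam (2 * ω₀) 1 0 0 1 0 := by
    funext ω
    simp only [quasiPoly]
    ring
  have h₂ : (fun ω : ℝ => ((ω : ℂ) ^ 2 / 2 + 2 * ω₀ * ω + 2 * (ω₀ : ℂ) ^ 2) * exp (lam * ω) -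
      (ω : ℂ) ^ 2 / 2 * exp (-(lam * ω))) =
      quasiPoly lam (2 * ω₀ ^ 2) (2 * ω₀) (1 / 2) 0 0 (-1 / 2) := by
    funext ω
    simp only [quasiPoly]
    ring
  rw [h₀, h₁, h₂]
  refine ⟨⟨⟨?_, ?_⟩, ?_⟩, ⟨?_, ?_⟩, ⟨?_, ?_⟩⟩
  · obtain ⟨φ', φ'', hC, h⟩ := exists_c2On_quasiPoly ω₀ lam 1 0 0 (-1) 0 0
    refine ⟨φ', φ'', hC, fun ω _ => ?_⟩
    rw [h]
    simp only [quasiPoly]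
    ring
  · exact nonlocalBC_quasiPoly hω₀.ne' k (by ring) (by ring)
  · have hk1 : (1 : ℝ) ≤ |(k : ℝ)| := by exact_mod_cast Int.one_le_abs hk
    have hkC : (k : ℂ) ≠ 0 := Int.cast_ne_zero.mpr hk
    refine ⟨ω₀ / (2 * k), abs_le.mp ?_, ?_⟩
    · rw [abs_div, abs_mul, abs_two, abs_of_pos hω₀]
      exact div_le_self hω₀.le (by linarith)
    · have hval : lam * ((ω₀ / (2 * k) : ℝ) : ℂ) = Real.pi / 2 * I := by
        rw [hlam]
        push_cast
        field_simp
      simp only [quasiPoly, hval, exp_neg, exp_pi_div_two_mul_I, inv_I]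
      ring_nf
      simp
  · obtain ⟨φ', φ'', hC, h⟩ := exists_c2On_quasiPoly ω₀ lam (2 * ω₀) 1 0 0 1 0
    refine ⟨φ', φ'', hC, fun ω _ => ?_⟩
    rw [h]
    simp only [quasiPoly]
    ring
  · exact nonlocalBC_quasiPoly hω₀.ne' k (by ring) (by ring)
  · obtain ⟨φ', φ'', hC, h⟩ :=
      exists_c2On_quasiPoly ω₀ lam (2 * ω₀ ^ 2) (2 * ω₀) (1 / 2) 0 0 (-1 / 2)
    refine ⟨φ', φ'', hC, fun ω _ => ?_⟩
    rw [h]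
    simp only [quasiPoly]
    ring
  · exact nonlocalBC_quasiPoly hω₀.ne' k (by ring) (by ring)
end

section
/- Let 0 < ω₀ < π, k a nonzero integer, b = 2·(−1)^{k+1}, λ = i·πk/ω₀, and let φ⁽¹⁾(ω) = (ω + 2ω₀)·exp(i·πk·ω/ω₀) + ω·exp(−i·πk·ω/ω₀) and φ⁽²⁾(ω) = (ω²/2 + 2ω₀·ω + 2ω₀²)·exp(i·πk·ω/ω₀) − (ω²/2)·exp(−i·πk·ω/ω₀). Then there is no twice continuously differentiable function ψ : [−ω₀, ω₀] → ℂ satisfying ψ''(ω) − λ²·ψ(ω) − 2λ·φ⁽²⁾(ω) − φ⁽¹⁾(ω) = 0 on [−ω₀, ω₀], ψ(−ω₀) = 0 and ψ(ω₀) + b·ψ(0) = 0; that is, the Jordan chain (φ⁽⁰⁾, φ⁽¹⁾, φ⁽²⁾) admits no third associated vector. -/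
open Set Complex

/-- A solution of `g' = μ g` on `[a, b]` is `g a * exp (μ (x - a))`. -/
theorem eq_mul_exp_of_hasDerivWithinAt {a b : ℝ} {μ : ℂ} {g : ℝ → ℂ}
    (hg : ∀ x ∈ Icc a b, HasDerivWithinAt g (μ * g x) (Icc a b) x) {x : ℝ} (hx : x ∈ Icc a b) :
    g x = g a * Complex.exp (μ * (x - a)) := by
  have hd : ∀ y ∈ Icc a b,
      HasDerivWithinAt (fun y : ℝ => Complex.exp (-μ * (y - a)) * g y) 0 (Icc a b) y := by
    intro y hy
    have h₁ : HasDerivAt (fun y : ℝ => -μ * ((y : ℂ) - a)) (-μ) y := by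
      simpa using ((Complex.ofRealCLM.hasDerivAt (x := y)).sub_const (a : ℂ)).const_mul (-μ)
    exact (h₁.cexp.hasDerivWithinAt.mul (hg y hy)).congr_deriv (by ring)
  have hc := constant_of_derivWithin_zero (fun y hy => (hd y hy).differentiableWithinAt)
    (fun y hy => (hd y ⟨hy.1, hy.2.le⟩).derivWithin
      (uniqueDiffOn_Icc (hy.1.trans_lt hy.2) y ⟨hy.1, hy.2.le⟩)) x hx
  simp only [sub_self, mul_zero, Complex.exp_zero, one_mul] at hc
  rw [← hc, mul_right_comm, ← Complex.exp_add]
  simp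

/-- Solutions of `h'' = μ² h` in terms of initial data at `a`. -/
theorem two_mul_mul_eq_of_hasDerivWithinAt {a b : ℝ} {μ : ℂ} {h h' h'' : ℝ → ℂ}
    (hh : ∀ x ∈ Icc a b, HasDerivWithinAt h (h' x) (Icc a b) x)
    (hh' : ∀ x ∈ Icc a b, HasDerivWithinAt h' (h'' x) (Icc a b) x)
    (hode : ∀ x ∈ Icc a b, h'' x = μ ^ 2 * h x) {x : ℝ} (hx : x ∈ Icc a b) :
    2 * μ * h x = (h' a + μ * h a) * Complex.exp (μ * (x - a)) -
      (h' a - μ * h a) * Complex.exp (-μ * (x - a)) := by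
  have h₁ := eq_mul_exp_of_hasDerivWithinAt (μ := μ) (g := fun y => h' y + μ * h y)
    (fun y hy => ((hh' y hy).add ((hh y hy).const_mul μ)).congr_deriv
      (by rw [hode y hy]; ring)) hx
  have h₂ := eq_mul_exp_of_hasDerivWithinAt (μ := -μ) (g := fun y => h' y - μ * h y)
    (fun y hy => ((hh' y hy).sub ((hh y hy).const_mul μ)).congr_deriv
      (by rw [hode y hy]; ring)) hx
  linear_combination h₁ - h₂

/-- Derivative of a product with an exponential. -/
theorem hasDerivAt_mul_cexp {p : ℝ → ℂ} {p' : ℂ} {x : ℝ} (μ : ℂ) (hp : HasDerivAt p p' x) :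
    HasDerivAt (fun y : ℝ => p y * Complex.exp (μ * y))
      ((p' + μ * p x) * Complex.exp (μ * x)) x := by
  have h₁ : HasDerivAt (fun y : ℝ => μ * (y : ℂ)) μ x := by
    simpa using (Complex.ofRealCLM.hasDerivAt (x := x)).const_mul μ
  exact (hp.mul h₁.cexp).congr_deriv (by ring)

/-- Derivative of a shifted power of the real variable, with complex values. -/
theorem hasDerivAt_ofReal_add_pow (c : ℂ) (n : ℕ) (x : ℝ) :
    HasDerivAt (fun y : ℝ => ((y : ℂ) + c) ^ n) (n * ((x : ℂ) + c) ^ (n - 1)) x :=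
  (((Complex.ofRealCLM.hasDerivAt (x := x)).add_const c).pow n).congr_deriv (by simp)

/-- First derivative of the cubic quasi-polynomial `(x + c)³ / 6 * exp (μ x)`. -/
theorem hasDerivAt_cubic_mul_cexp (c μ : ℂ) (x : ℝ) :
    HasDerivAt (fun y : ℝ => ((y : ℂ) + c) ^ 3 / 6 * Complex.exp (μ * y))
      ((((x : ℂ) + c) ^ 2 / 2 + μ * (((x : ℂ) + c) ^ 3 / 6)) * Complex.exp (μ * x)) x :=
  (hasDerivAt_mul_cexp μ ((hasDerivAt_ofReal_add_pow c 3 x).div_const 6)).congr_deriv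
    (by push_cast; ring)

/-- Second derivative of the cubic quasi-polynomial `(x + c)³ / 6 * exp (μ x)`. -/
theorem hasDerivAt_deriv_cubic_mul_cexp (c μ : ℂ) (x : ℝ) :
    HasDerivAt (fun y : ℝ => (((y : ℂ) + c) ^ 2 / 2 + μ * (((y : ℂ) + c) ^ 3 / 6)) *
        Complex.exp (μ * y))
      ((((x : ℂ) + c) + μ * ((x : ℂ) + c) ^ 2 + μ ^ 2 * (((x : ℂ) + c) ^ 3 / 6)) *
        Complex.exp (μ * x)) x :=
  (hasDerivAt_mul_cexp μ (((hasDerivAt_ofReal_add_pow c 2 x).div_const 2).add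
    (((hasDerivAt_ofReal_add_pow c 3 x).div_const 6).const_mul μ))).congr_deriv
    (by simp only [Pi.add_apply]; push_cast; ring)

/-- For `b = 2·(-1)^{k+1}` and `λ = i·πk/ω₀`, the Jordan chain `(φ⁽⁰⁾, φ⁽¹⁾, φ⁽²⁾)`
admits no third associated vector. -/
theorem statement6 (ω₀ : ℝ) (hω₀ : 0 < ω₀) (hω₀' : ω₀ < Real.pi)
    (k : ℤ) (hk : k ≠ 0) :
    ¬ ∃ ψ : ℝ → ℂ,
        IsAssociatedSol ω₀ (2 * (-1 : ℝ) ^ (k + 1)) (Complex.I * (Real.pi * k) / ω₀)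
          (fun ω => 2 * (Complex.I * (Real.pi * k) / ω₀) *
              (((ω : ℂ) ^ 2 / 2 + 2 * (ω₀ : ℂ) * ω + 2 * (ω₀ : ℂ) ^ 2) *
                  Complex.exp (Complex.I * (Real.pi * k) * ω / ω₀) -
                ((ω : ℂ) ^ 2 / 2) * Complex.exp (-(Complex.I * (Real.pi * k) * ω) / ω₀)) +
            (((ω : ℂ) + 2 * (ω₀ : ℂ)) * Complex.exp (Complex.I * (Real.pi * k) * ω / ω₀) +
              (ω : ℂ) * Complex.exp (-(Complex.I * (Real.pi * k) * ω) / ω₀))) ψ := by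
  rintro ⟨ψ, ⟨ψ', ψ'', ⟨hψ, hψ', -⟩, hode⟩, hbc₁, hbc₂⟩
  have hw : (ω₀ : ℂ) ≠ 0 := by exact_mod_cast hω₀.ne'
  have e₁ (x : ℝ) : Complex.I * (Real.pi * k) * x / ω₀ =
      Complex.I * (Real.pi * k) / ω₀ * x := by ring
  have e₂ (x : ℝ) : -(Complex.I * (Real.pi * k) * x) / ω₀ =
      -(Complex.I * (Real.pi * k) / ω₀) * x := by ring
  simp only [e₁, e₂] at hode
  have hlw : Complex.I * (Real.pi * k) / ω₀ * ω₀ = k * (Real.pi * Complex.I) := by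
    field_simp
  have hlam : Complex.I * (Real.pi * k) / ω₀ ≠ 0 := by
    simp [hw, hk, Real.pi_ne_zero]
  generalize Complex.I * (Real.pi * k) / ω₀ = μ at *
  obtain ⟨s, hs⟩ : ∃ s : ℂ, s = (-1) ^ k := ⟨_, rfl⟩
  have hexp : Complex.exp (μ * ω₀) = s := by
    rw [hlw, Complex.exp_int_mul, Complex.exp_pi_mul_I, hs]
  have hss : s * s = 1 := by
    rw [hs, ← mul_zpow]; simp
  have hs0 : s ≠ 0 := left_ne_zero_of_mul_eq_one hss
  have hexp' : Complex.exp (-(μ * ω₀)) = s := by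
    rw [Complex.exp_neg, hexp, inv_eq_of_mul_eq_one_left hss]
  have hb : ((2 * (-1 : ℝ) ^ (k + 1) : ℝ) : ℂ) = -2 * s := by
    rw [zpow_add₀ (by norm_num), hs]; push_cast; ring
  rw [hb] at hbc₂
  have key {x : ℝ} (hx : x ∈ Icc (-ω₀) ω₀) :=
    two_mul_mul_eq_of_hasDerivWithinAt (μ := μ)
      (fun y hy => (hψ y hy).sub ((hasDerivAt_cubic_mul_cexp (2 * ω₀) μ y).add
        (hasDerivAt_cubic_mul_cexp 0 (-μ) y)).hasDerivWithinAt)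
      (fun y hy => (hψ' y hy).sub ((hasDerivAt_deriv_cubic_mul_cexp (2 * ω₀) μ y).add
        (hasDerivAt_deriv_cubic_mul_cexp 0 (-μ) y)).hasDerivWithinAt)
      (fun y hy => by
        simp only [Pi.sub_apply, Pi.add_apply]
        linear_combination hode y hy) hx
  have k₀ := key (x := 0) ⟨by linarith, hω₀.le⟩
  have k₁ := key (x := ω₀) ⟨by linarith, le_rfl⟩
  have hexp2 : Complex.exp (μ * (ω₀ + ω₀)) = 1 := by
    rw [mul_add, Complex.exp_add, hexp, hss]
  have hexp2' : Complex.exp (-(μ * (ω₀ + ω₀))) = 1 := by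
    rw [Complex.exp_neg, hexp2, inv_one]
  simp only [Pi.sub_apply, Pi.add_apply, hbc₁] at k₀ k₁
  simp only [Complex.ofReal_neg, Complex.ofReal_zero, sub_neg_eq_add, zero_add, add_zero,
    neg_mul, mul_neg, neg_neg, mul_zero, Complex.exp_zero, hexp, hexp', hexp2,
    hexp2'] at k₀ k₁
  have hfinal : (2 * μ) * (2 * s * (ω₀ : ℂ) ^ 3) = 0 := by
    linear_combination -k₁ + 2 * s * k₀ + 2 * μ * hbc₂
  simp [hlam, hs0, hw] at hfinal
end

section
/- Let 0 < ω₀ < π and n ∈ ℤ. If b < −2, then for either choice of sign the number λ = (1/ω₀)·ln(−b/2 ± √(b² − 4)/2) + i·2πn/ω₀ is nonzero and satisfies e^{λω₀} + e^{−λω₀} + b = 0, and hence is an eigenvalue of the model nonlocal eigenvalue problem. If b > 2, then for either choice of sign the number λ = (1/ω₀)·ln(b/2 ± √(b² − 4)/2) + i·(2n+1)π/ω₀ is nonzero and satisfies e^{λω₀} + e^{−λω₀} + b = 0, and hence is an eigenvalue of the model nonlocal eigenvalue problem. -/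
open Set Complex

theorem exp_add_exp_neg_eq {ω₀ b : ℝ} {lam E : ℂ} (hE : Complex.exp (lam * ω₀) = E)
    (h : E + E⁻¹ + (b : ℂ) = 0) :
    Complex.exp (lam * ω₀) + Complex.exp (-lam * ω₀) + (b : ℂ) = 0 := by
  rw [neg_mul, Complex.exp_neg, hE, h]

theorem hasDerivAt_exp_mul_add (lam : ℂ) (a ω : ℝ) :
    HasDerivAt (fun x : ℝ => Complex.exp (lam * ((x : ℂ) + a)))
      (lam * Complex.exp (lam * ((ω : ℂ) + a))) ω := by
  have h : HasDerivAt (fun x : ℝ => lam * ((x : ℂ) + a)) lam ω := by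
    simpa using ((Complex.ofRealCLM.hasDerivAt (x := ω)).add_const (a : ℂ)).const_mul lam
  simpa [mul_comm] using h.cexp

/-- A root of the characteristic equation is an eigenvalue when `b ≠ ± 2`, with eigenvector
`exp (λ (ω + ω₀)) - exp (-λ (ω + ω₀))`. -/
theorem isEigenvalue_of_exp_add_exp_neg {ω₀ b : ℝ} (hω₀ : 0 < ω₀) {lam : ℂ}
    (hb : b ^ 2 ≠ 4)
    (h : Complex.exp (lam * ω₀) + Complex.exp (-lam * ω₀) + (b : ℂ) = 0) :
    IsEigenvalue ω₀ b lam := by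
  have d := fun ω => hasDerivAt_exp_mul_add lam ω₀ ω
  have d' := fun ω => hasDerivAt_exp_mul_add (-lam) ω₀ ω
  have hmul : Complex.exp (lam * ω₀) * Complex.exp (-lam * ω₀) = 1 := by
    rw [← Complex.exp_add]; simp
  refine ⟨fun ω => Complex.exp (lam * ((ω : ℂ) + ω₀)) - Complex.exp (-lam * ((ω : ℂ) + ω₀)),
    ⟨⟨fun ω => lam * Complex.exp (lam * ((ω : ℂ) + ω₀))
        - -lam * Complex.exp (-lam * ((ω : ℂ) + ω₀)),
      fun ω => lam * (lam * Complex.exp (lam * ((ω : ℂ) + ω₀)))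
        - -lam * (-lam * Complex.exp (-lam * ((ω : ℂ) + ω₀))),
      ⟨fun ω _ => ((d ω).sub (d' ω)).hasDerivWithinAt,
        fun ω _ => (((d ω).const_mul lam).sub ((d' ω).const_mul (-lam))).hasDerivWithinAt,
        by fun_prop⟩, fun ω _ => by ring⟩, by simp, ?_⟩,
    0, ⟨by linarith, hω₀.le⟩, ?_⟩
  · have h₁ : Complex.exp (lam * ((ω₀ : ℂ) + ω₀)) = Complex.exp (lam * ω₀) ^ 2 := by
      rw [mul_add, Complex.exp_add, sq]
    have h₂ : Complex.exp (-lam * ((ω₀ : ℂ) + ω₀)) = Complex.exp (-lam * ω₀) ^ 2 := by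
      rw [mul_add, Complex.exp_add, sq]
    simp only [h₁, h₂, Complex.ofReal_zero, zero_add]
    linear_combination (Complex.exp (lam * ω₀) - Complex.exp (-lam * ω₀)) * h
  · simp only [Complex.ofReal_zero, zero_add]
    intro h0
    apply hb
    have : (b : ℂ) ^ 2 = 4 := by
      linear_combination (b - Complex.exp (lam * ω₀) - Complex.exp (-lam * ω₀)) * h
        + (Complex.exp (lam * ω₀) - Complex.exp (-lam * ω₀)) * h0 + 4 * hmul
    exact_mod_cast this

theorem ne_zero_of_exp_add_exp_neg {ω₀ b : ℝ} {lam : ℂ} (hb : b ≠ -2)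
    (h : Complex.exp (lam * ω₀) + Complex.exp (-lam * ω₀) + (b : ℂ) = 0) : lam ≠ 0 := by
  rintro rfl
  apply hb
  have : (b : ℂ) = -2 := by
    simp only [neg_zero, zero_mul, Complex.exp_zero] at h
    linear_combination h
  exact_mod_cast this

theorem half_add_sqrt_pos_and_add_inv {c s : ℝ} (hc : 2 < c) (hs : s = 1 ∨ s = -1) :
    0 < c / 2 + s * (Real.sqrt (c ^ 2 - 4) / 2) ∧
      c / 2 + s * (Real.sqrt (c ^ 2 - 4) / 2) + (c / 2 + s * (Real.sqrt (c ^ 2 - 4) / 2))⁻¹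
        = c := by
  have hsq : Real.sqrt (c ^ 2 - 4) ^ 2 = c ^ 2 - 4 := Real.sq_sqrt (by nlinarith)
  have hlt : Real.sqrt (c ^ 2 - 4) < c := (Real.sqrt_lt' (by linarith)).2 (by linarith)
  have hs2 : s ^ 2 = 1 := by rcases hs with rfl | rfl <;> norm_num
  have hpos : 0 < c / 2 + s * (Real.sqrt (c ^ 2 - 4) / 2) := by
    rcases hs with rfl | rfl <;> linarith [Real.sqrt_nonneg (c ^ 2 - 4)]
  have hinv : (c / 2 + s * (Real.sqrt (c ^ 2 - 4) / 2))⁻¹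
      = c / 2 - s * (Real.sqrt (c ^ 2 - 4) / 2) := by
    apply inv_eq_of_mul_eq_one_right
    linear_combination (-s ^ 2 / 4) * hsq - (c ^ 2 - 4) / 4 * hs2
  exact ⟨hpos, by rw [hinv]; ring⟩

theorem exp_log_div_add_mul {ω₀ r θ : ℝ} (hω₀ : 0 < ω₀) (hr : 0 < r) :
    Complex.exp ((((Real.log r / ω₀ : ℝ) : ℂ) + Complex.I * ((θ / ω₀ : ℝ) : ℂ)) * ω₀)
      = r * Complex.exp (θ * Complex.I) := by
  have hω : (ω₀ : ℂ) ≠ 0 := by exact_mod_cast hω₀.ne'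
  have : (((Real.log r / ω₀ : ℝ) : ℂ) + Complex.I * ((θ / ω₀ : ℝ) : ℂ)) * ω₀
      = (Real.log r : ℂ) + θ * Complex.I := by
    push_cast
    field_simp
  rw [this, Complex.exp_add, ← Complex.ofReal_exp, Real.exp_log hr]

/-- The real series of eigenvalues for `b < -2` and `b > 2`:
for `b < -2`, `λ = (1/ω₀)·ln(-b/2 ± √(b²-4)/2) + i·2πn/ω₀` is a nonzero root of
`e^{λω₀} + e^{-λω₀} + b = 0` and hence an eigenvalue; for `b > 2`,
`λ = (1/ω₀)·ln(b/2 ± √(b²-4)/2) + i·(2n+1)π/ω₀` is a nonzero root and hence an eigenvalue. -/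
theorem statement8 (ω₀ b : ℝ) (hω₀ : 0 < ω₀) (hω₀' : ω₀ < Real.pi) (n : ℤ) :
    (b < -2 → ∀ s : ℝ, (s = 1 ∨ s = -1) → ∀ lam : ℂ,
      lam = ((Real.log (-b / 2 + s * (Real.sqrt (b ^ 2 - 4) / 2)) / ω₀ : ℝ) : ℂ) +
          Complex.I * ((2 * Real.pi * (n : ℝ) / ω₀ : ℝ) : ℂ) →
      lam ≠ 0 ∧ Complex.exp (lam * ω₀) + Complex.exp (-lam * ω₀) + (b : ℂ) = 0 ∧
        IsEigenvalue ω₀ b lam) ∧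
    (b > 2 → ∀ s : ℝ, (s = 1 ∨ s = -1) → ∀ lam : ℂ,
      lam = ((Real.log (b / 2 + s * (Real.sqrt (b ^ 2 - 4) / 2)) / ω₀ : ℝ) : ℂ) +
          Complex.I * (((2 * (n : ℝ) + 1) * Real.pi / ω₀ : ℝ) : ℂ) →
      lam ≠ 0 ∧ Complex.exp (lam * ω₀) + Complex.exp (-lam * ω₀) + (b : ℂ) = 0 ∧
        IsEigenvalue ω₀ b lam) := by
  refine ⟨fun hb s hs lam hlam => ?_, fun hb s hs lam hlam => ?_⟩
  · obtain ⟨hr, hsum⟩ := half_add_sqrt_pos_and_add_inv (c := -b) (by linarith) hs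
    rw [neg_sq] at hr hsum
    have hθ : Complex.exp ((2 * Real.pi * (n : ℝ) : ℝ) * Complex.I) = 1 :=
      Complex.exp_eq_one_iff.2 ⟨n, by push_cast; ring⟩
    have hE := exp_log_div_add_mul (θ := 2 * Real.pi * (n : ℝ)) hω₀ hr
    rw [← hlam, hθ, mul_one] at hE
    have h := exp_add_exp_neg_eq (b := b) hE
      (by exact_mod_cast (by linarith : _ + _ + b = 0))
    exact ⟨ne_zero_of_exp_add_exp_neg hb.ne h, h,
      isEigenvalue_of_exp_add_exp_neg hω₀ (by nlinarith) h⟩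
  · obtain ⟨hr, hsum⟩ := half_add_sqrt_pos_and_add_inv hb hs
    have hθ : Complex.exp (((2 * (n : ℝ) + 1) * Real.pi : ℝ) * Complex.I) = -1 := by
      rw [← Complex.exp_pi_mul_I, Complex.exp_eq_exp_iff_exists_int]
      exact ⟨n, by push_cast; ring⟩
    have hE := exp_log_div_add_mul (θ := (2 * (n : ℝ) + 1) * Real.pi) hω₀ hr
    rw [← hlam, hθ, mul_neg_one] at hE
    have h := exp_add_exp_neg_eq (b := b) hE (by
      rw [inv_neg]
      exact_mod_cast (by linarith : -_ + -_ + b = 0))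
    exact ⟨ne_zero_of_exp_add_exp_neg (by linarith) h, h,
      isEigenvalue_of_exp_add_exp_neg hω₀ (by nlinarith) h⟩
end

section
/- Let 0 < ω₀ < π and n ∈ ℤ. If −2 < b < 0, then for either choice of sign the number λ = i·(± arctan(√(4 − b²)/b) + 2πn)/ω₀ is nonzero for all but at most one pair (sign, n) — in fact always nonzero — and satisfies e^{λω₀} + e^{−λω₀} + b = 0, and hence is an eigenvalue of the model nonlocal eigenvalue problem. If 0 < b < 2, then for either choice of sign the number λ = i·(± arctan(√(4 − b²)/b) + (2n+1)π)/ω₀ is nonzero and satisfies e^{λω₀} + e^{−λω₀} + b = 0, and hence is an eigenvalue of the model nonlocal eigenvalue problem. -/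
open Set Complex

/-- If `e^{λω₀} + e^{-λω₀} + b = 0` and `sinh (λω₀) ≠ 0`, then `λ` is an eigenvalue, with
eigenvector `sinh (λ(ω + ω₀))`. -/
theorem isEigenvalue_of_exp_add_exp_neg_s9 {ω₀ b : ℝ} (hω₀ : 0 < ω₀) {lam : ℂ}
    (hchar : exp (lam * ω₀) + exp (-lam * ω₀) + (b : ℂ) = 0)
    (hsinh : sinh (lam * ω₀) ≠ 0) : IsEigenvalue ω₀ b lam := by
  have hlin (ω : ℝ) : HasDerivAt (fun ω : ℝ => lam * ((ω : ℂ) + ω₀)) lam ω := by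
    simpa using ((ofRealCLM.hasDerivAt (x := ω)).add_const (ω₀ : ℂ)).const_mul lam
  refine ⟨fun ω => sinh (lam * ((ω : ℂ) + ω₀)),
    ⟨⟨fun ω => cosh (lam * ((ω : ℂ) + ω₀)) * lam,
      fun ω => sinh (lam * ((ω : ℂ) + ω₀)) * lam * lam,
      ⟨fun ω _ => ((hasDerivAt_sinh _).comp ω (hlin ω)).hasDerivWithinAt,
        fun ω _ => (((hasDerivAt_cosh _).comp ω (hlin ω)).mul_const lam).hasDerivWithinAt, by fun_prop⟩,
      fun ω _ => by ring⟩, by simp, ?_⟩, 0, ⟨by linarith, hω₀.le⟩, by simpa using hsinh⟩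
  have hcosh : 2 * cosh (lam * ω₀) + b = 0 := by
    rw [two_cosh, ← neg_mul]
    exact hchar
  have harg : lam * ((ω₀ : ℂ) + ω₀) = 2 * (lam * ω₀) := by ring
  simp only [harg, sinh_two_mul, ofReal_zero, zero_add]
  linear_combination sinh (lam * ω₀) * hcosh

theorem eigenvalue_of_cos_eq {ω₀ b θ : ℝ} (hω₀ : 0 < ω₀) (hb : b ^ 2 < 4)
    (hcos : Real.cos θ = -b / 2) {lam : ℂ} (hlam : lam = I * ((θ / ω₀ : ℝ) : ℂ)) :
    lam ≠ 0 ∧ exp (lam * ω₀) + exp (-lam * ω₀) + (b : ℂ) = 0 ∧ IsEigenvalue ω₀ b lam := by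
  have hmul : lam * ω₀ = θ * I := by
    have : (ω₀ : ℂ) ≠ 0 := ofReal_ne_zero.mpr hω₀.ne'
    rw [hlam]
    push_cast
    field_simp
  have hsin : Real.sin θ ≠ 0 := fun h => by
    have := Real.sin_sq_add_cos_sq θ
    rw [h, hcos] at this
    nlinarith
  have hsinh : sinh (lam * ω₀) ≠ 0 := by
    rw [hmul, sinh_mul_I, ← ofReal_sin]
    exact mul_ne_zero (ofReal_ne_zero.mpr hsin) I_ne_zero
  have hchar : exp (lam * ω₀) + exp (-lam * ω₀) + (b : ℂ) = 0 := by
    rw [neg_mul, ← two_cosh, hmul, cosh_mul_I, ← ofReal_cos, hcos]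
    push_cast
    ring
  exact ⟨fun h => hsinh (by simp [h]), hchar, isEigenvalue_of_exp_add_exp_neg_s9 hω₀ hchar hsinh⟩

theorem cos_arctan_sqrt_four_sub_sq_div {b : ℝ} (hb : b ≠ 0) (hb' : b ^ 2 < 4) :
    Real.cos (Real.arctan (Real.sqrt (4 - b ^ 2) / b)) = |b| / 2 := by
  have hsq : 1 + (Real.sqrt (4 - b ^ 2) / b) ^ 2 = (2 / |b|) ^ 2 := by
    rw [div_pow, div_pow, Real.sq_sqrt (by linarith), sq_abs]
    field_simp
    ring
  rw [Real.cos_arctan, hsq, Real.sqrt_sq (by positivity), one_div_div]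

theorem cos_sign_mul {s : ℝ} (hs : s = 1 ∨ s = -1) (x : ℝ) :
    Real.cos (s * x) = Real.cos x := by
  rcases hs with rfl | rfl <;> simp

/-- The purely imaginary series of eigenvalues for `-2 < b < 0` and `0 < b < 2`:
for `-2 < b < 0`, `λ = i·(±arctan(√(4-b²)/b) + 2πn)/ω₀` is (always) nonzero, satisfies
`e^{λω₀} + e^{-λω₀} + b = 0`, and hence is an eigenvalue; for `0 < b < 2`,
`λ = i·(±arctan(√(4-b²)/b) + (2n+1)π)/ω₀` is nonzero, satisfies the same equation, and
hence is an eigenvalue. -/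
theorem statement9 (ω₀ b : ℝ) (hω₀ : 0 < ω₀) (hω₀' : ω₀ < Real.pi) (n : ℤ) :
    (-2 < b → b < 0 → ∀ s : ℝ, (s = 1 ∨ s = -1) → ∀ lam : ℂ,
      lam = Complex.I *
          (((s * Real.arctan (Real.sqrt (4 - b ^ 2) / b) + 2 * Real.pi * (n : ℝ)) / ω₀ : ℝ) : ℂ) →
      lam ≠ 0 ∧ Complex.exp (lam * ω₀) + Complex.exp (-lam * ω₀) + (b : ℂ) = 0 ∧
        IsEigenvalue ω₀ b lam) ∧
    (0 < b → b < 2 → ∀ s : ℝ, (s = 1 ∨ s = -1) → ∀ lam : ℂ,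
      lam = Complex.I *
          (((s * Real.arctan (Real.sqrt (4 - b ^ 2) / b) + (2 * (n : ℝ) + 1) * Real.pi) / ω₀ : ℝ) : ℂ) →
      lam ≠ 0 ∧ Complex.exp (lam * ω₀) + Complex.exp (-lam * ω₀) + (b : ℂ) = 0 ∧
        IsEigenvalue ω₀ b lam) := by
  refine ⟨fun hb hb' s hs lam hlam => ?_, fun hb hb' s hs lam hlam => ?_⟩
  · have hsq : b ^ 2 < 4 := by nlinarith
    refine eigenvalue_of_cos_eq hω₀ hsq ?_ hlam
    rw [mul_comm (2 * Real.pi), Real.cos_add_int_mul_two_pi, cos_sign_mul hs,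
      cos_arctan_sqrt_four_sub_sq_div hb'.ne hsq, abs_of_neg hb']
  · have hsq : b ^ 2 < 4 := by nlinarith
    refine eigenvalue_of_cos_eq hω₀ hsq ?_ hlam
    have hshift (x : ℝ) : x + (2 * (n : ℝ) + 1) * Real.pi =
        x + n * (2 * Real.pi) + Real.pi := by ring
    rw [hshift, Real.cos_add_pi, Real.cos_add_int_mul_two_pi, cos_sign_mul hs,
      cos_arctan_sqrt_four_sub_sq_div hb.ne' hsq, abs_of_pos hb, neg_div]
end

section
/- Let 0 < ω₀ < π, b ∈ ℝ with b ≠ 2 and b ≠ −2, and let λ ∈ ℂ be nonzero with e^{λω₀} + e^{−λω₀} + b = 0. Set φ⁽⁰⁾(ω) = e^{λω} − e^{−2λω₀}·e^{−λω}. Then there is no twice continuously differentiable function ψ : [−ω₀, ω₀] → ℂ satisfying ψ''(ω) − λ²·ψ(ω) − 2λ·φ⁽⁰⁾(ω) = 0 on [−ω₀, ω₀], ψ(−ω₀) = 0 and ψ(ω₀) + b·ψ(0) = 0; that is, the eigenvector φ⁽⁰⁾ admits no associated vector. -/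
open Set Complex

lemma Convex.eqOn_of_hasDerivWithinAt_zero {s : Set ℝ} (hs : Convex ℝ s) {f : ℝ → ℂ}
    (hf : ∀ x ∈ s, HasDerivWithinAt f 0 s x) {x y : ℝ} (hx : x ∈ s) (hy : y ∈ s) :
    f x = f y := by
  have h := hs.norm_image_sub_le_of_norm_hasDerivWithin_le (f' := fun _ => 0) (C := 0)
    hf (by simp) hy hx
  simpa [sub_eq_zero] using h

lemma hasDerivWithinAt_cexp_mul_ofReal (μ : ℂ) (s : Set ℝ) (x : ℝ) :
    HasDerivWithinAt (fun t : ℝ => Complex.exp (μ * t)) (μ * Complex.exp (μ * x)) s x := by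
  have h : HasDerivAt (fun z : ℂ => Complex.exp (μ * z)) (μ * Complex.exp (μ * x)) (x : ℂ) := by
    simpa [mul_comm] using ((hasDerivAt_id (x : ℂ)).const_mul μ).cexp
  exact h.comp_ofReal.hasDerivWithinAt

/-- A first integral of `q'' = μ²·q` is `(q' + μ·q)·e^{-μω}`. -/
lemma firstIntegral_const {s : Set ℝ} (hs : Convex ℝ s) {q q' : ℝ → ℂ} {μ : ℂ}
    (hq : ∀ x ∈ s, HasDerivWithinAt q (q' x) s x)
    (hq' : ∀ x ∈ s, HasDerivWithinAt q' (μ ^ 2 * q x) s x) {x y : ℝ} (hx : x ∈ s) (hy : y ∈ s) :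
    (q' x + μ * q x) * Complex.exp (-μ * x) = (q' y + μ * q y) * Complex.exp (-μ * y) := by
  refine hs.eqOn_of_hasDerivWithinAt_zero
    (f := fun t => (q' t + μ * q t) * Complex.exp (-μ * t)) (fun t ht => ?_) hx hy
  refine (((hq' t ht).add ((hq t ht).const_mul μ)).mul
    (hasDerivWithinAt_cexp_mul_ofReal (-μ) s t)).congr_deriv ?_
  simp only [Pi.add_apply]
  ring

lemma exists_eq_exp_combination {s : Set ℝ} (hs : Convex ℝ s) {q q' : ℝ → ℂ} {μ : ℂ} (hμ : μ ≠ 0)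
    (hq : ∀ x ∈ s, HasDerivWithinAt q (q' x) s x)
    (hq' : ∀ x ∈ s, HasDerivWithinAt q' (μ ^ 2 * q x) s x) :
    ∃ A B : ℂ, ∀ x ∈ s, q x = A * Complex.exp (μ * x) + B * Complex.exp (-μ * x) := by
  rcases s.eq_empty_or_nonempty with rfl | ⟨y, hy⟩
  · exact ⟨0, 0, by simp⟩
  refine ⟨(q' y + μ * q y) * Complex.exp (-μ * y) / (2 * μ),
    -((q' y + -μ * q y) * Complex.exp (- -μ * y)) / (2 * μ), fun x hx => ?_⟩
  rw [← firstIntegral_const hs hq hq' hx hy,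
    ← firstIntegral_const (μ := -μ) hs hq (by simpa using hq') hx hy]
  have h : Complex.exp (μ * x) * Complex.exp (-μ * x) = 1 := by
    rw [← Complex.exp_add]; simp
  rw [neg_neg]
  simp only [neg_mul] at h ⊢
  field_simp
  linear_combination (-2 * μ * q x) * h

/-- If `b ≠ ±2` and `λ ≠ 0` satisfies `e^{λω₀} + e^{-λω₀} + b = 0`, then the eigenvector
`φ⁽⁰⁾(ω) = e^{λω} - e^{-2λω₀}·e^{-λω}` admits no associated vector. -/
theorem statement10 (ω₀ b : ℝ) (hω₀ : 0 < ω₀) (hω₀' : ω₀ < Real.pi)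
    (hb2 : b ≠ 2) (hb2' : b ≠ -2) (lam : ℂ) (hlam : lam ≠ 0)
    (heq : Complex.exp (lam * ω₀) + Complex.exp (-lam * ω₀) + (b : ℂ) = 0) :
    ¬ ∃ ψ : ℝ → ℂ, IsAssociatedSol ω₀ b lam
        (fun ω => 2 * lam * (Complex.exp (lam * ω) -
          Complex.exp (-2 * lam * ω₀) * Complex.exp (-lam * ω))) ψ := by
  rintro ⟨ψ, ⟨ψ', ψ'', ⟨hψ, hψ', -⟩, hode⟩, hleft, hright⟩
  set c : ℂ := Complex.exp (-2 * lam * ω₀) with hc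
  set I := Icc (-ω₀) ω₀ with hI
  have hid (x : ℝ) : HasDerivWithinAt (fun t : ℝ => (t : ℂ)) 1 I x :=
    (hasDerivAt_id (x : ℂ)).comp_ofReal.hasDerivWithinAt
  have hexp (μ : ℂ) (x : ℝ) := hasDerivWithinAt_cexp_mul_ofReal μ I x
  obtain ⟨A, B, hAB⟩ := exists_eq_exp_combination (convex_Icc (-ω₀) ω₀) hlam
    (q := fun t => ψ t - t * (Complex.exp (lam * t) + c * Complex.exp (-lam * t)))
    (q' := fun t => ψ' t - ((Complex.exp (lam * t) + c * Complex.exp (-lam * t)) +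
      t * (lam * Complex.exp (lam * t) - c * lam * Complex.exp (-lam * t))))
    (fun x hx => by
      refine ((hψ x hx).sub ((hid x).mul
        ((hexp lam x).add ((hexp (-lam) x).const_mul c)))).congr_deriv ?_
      simp only [Pi.add_apply]
      ring)
    (fun x hx => by
      refine ((hψ' x hx).sub (((hexp lam x).add ((hexp (-lam) x).const_mul c)).add
        ((hid x).mul (((hexp lam x).const_mul lam).sub
          ((hexp (-lam) x).const_mul (c * lam)))))).congr_deriv ?_
      simp only [Pi.sub_apply]
      linear_combination hode x hx)
  have h1 := hAB (-ω₀) ⟨le_rfl, by linarith⟩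
  have h2 := hAB ω₀ ⟨by linarith, le_rfl⟩
  have h3 := hAB 0 ⟨by linarith, hω₀.le⟩
  set z := Complex.exp (lam * ω₀) with hz
  set w := Complex.exp (-lam * ω₀) with hw
  have hzw : z * w = 1 := by rw [hz, hw, ← Complex.exp_add]; simp
  have hcw : c = w ^ 2 := by
    rw [hc, hw, ← Complex.exp_nat_mul]; congr 1; push_cast; ring
  have hl : Complex.exp (lam * ((-ω₀ : ℝ) : ℂ)) = w := by rw [hw]; congr 1; push_cast; ring
  have hr : Complex.exp (-lam * ((-ω₀ : ℝ) : ℂ)) = z := by rw [hz]; congr 1; push_cast; ring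
  simp only [hl, hr, hleft, hcw] at h1
  rw [ofReal_neg] at h1
  simp only [hcw] at h2
  simp only [ofReal_zero, mul_zero, Complex.exp_zero, zero_mul, sub_zero, mul_one] at h3
  have hω : (ω₀ : ℂ) ≠ 0 := ofReal_ne_zero.mpr hω₀.ne'
  have key : (ω₀ : ℂ) * (z + w ^ 3 - 2 * w) = 0 := by
    linear_combination hright - h2 - b * h3 - (A + B) * heq - h1 + ω₀ * w * hzw
  have key' : z + w ^ 3 - 2 * w = 0 := (mul_eq_zero.mp key).resolve_left hω
  have hsq : (w ^ 2 - 1) ^ 2 = 0 := by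
    linear_combination w * key' - hzw
  have hw1 : (w - 1) * (w + 1) = 0 := by
    linear_combination (pow_eq_zero_iff two_ne_zero).mp hsq
  rcases mul_eq_zero.mp hw1 with h | h
  · have : (b : ℂ) = ((-2 : ℝ) : ℂ) := by
      push_cast
      linear_combination heq - hzw + (z - 1) * h
    exact hb2' (ofReal_injective this)
  · have : (b : ℂ) = ((2 : ℝ) : ℂ) := by
      push_cast
      linear_combination heq + hzw - (z + 1) * h
    exact hb2 (ofReal_injective this)
end

section
/- Let 0 < ω₀ < π and b = −2. Then the pair (φ⁽⁰⁾, φ⁽¹⁾) with φ⁽⁰⁾(ω) = ω + ω₀ and φ⁽¹⁾ ≡ 0 is a Jordan chain of length 2 at the eigenvalue λ = 0 of the model nonlocal eigenvalue problem, and there is no second associated vector: there is no twice continuously differentiable ψ : [−ω₀, ω₀] → ℂ with ψ''(ω) = ω + ω₀ on [−ω₀, ω₀], ψ(−ω₀) = 0 and ψ(ω₀) − 2ψ(0) = 0. -/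
open Set Complex

/-- A function with vanishing derivative on `[a, b]` takes its value at `a` throughout. -/
theorem eq_left_of_hasDerivWithinAt_zero {a b : ℝ} {g : ℝ → ℂ}
    (h : ∀ x ∈ Icc a b, HasDerivWithinAt g 0 (Icc a b) x) {x : ℝ} (hx : x ∈ Icc a b) :
    g x = g a := by
  have ha : a ∈ Icc a b := ⟨le_rfl, hx.1.trans hx.2⟩
  have hle := (convex_Icc a b).norm_image_sub_le_of_norm_hasDerivWithin_le (C := 0) h
    (fun _ _ => by simp) ha hx
  rw [zero_mul] at hle
  exact sub_eq_zero.mp (norm_le_zero_iff.mp hle)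

/-- The shift `ω ↦ ω + c` of the real line into `ℂ` has derivative `1`. -/
theorem hasDerivWithinAt_ofReal_add_const (c : ℂ) (s : Set ℝ) (x : ℝ) :
    HasDerivWithinAt (fun ω : ℝ => (ω : ℂ) + c) 1 s x :=
  ((hasDerivAt_id x).ofReal_comp.add_const c).hasDerivWithinAt

/-- A solution of `ψ'' = ω + ω₀` with `ψ(-ω₀) = 0` is `(ω + ω₀)³ / 6` plus a multiple of
`ω + ω₀`. -/
theorem C2On.exists_eq_cubic {ω₀ : ℝ} {ψ ψ' ψ'' : ℝ → ℂ} (h : C2On ω₀ ψ ψ' ψ'')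
    (hode : ∀ ω ∈ Icc (-ω₀) ω₀, ψ'' ω = ω + ω₀) (hleft : ψ (-ω₀) = 0) :
    ∃ c : ℂ, ∀ ω ∈ Icc (-ω₀) ω₀, ψ ω = ((ω : ℂ) + ω₀) ^ 3 / 6 + c * (ω + ω₀) := by
  obtain ⟨hψ, hψ', -⟩ := h
  have hshift := hasDerivWithinAt_ofReal_add_const (ω₀ : ℂ) (Icc (-ω₀) ω₀)
  have hfirst : ∀ ω ∈ Icc (-ω₀) ω₀, ψ' ω = ((ω : ℂ) + ω₀) ^ 2 / 2 + ψ' (-ω₀) := by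
    intro ω hω
    have := eq_left_of_hasDerivWithinAt_zero
      (g := fun ω => ψ' ω - ((ω : ℂ) + ω₀) ^ 2 / 2)
      (fun x hx => ((hψ' x hx).sub (((hshift x).pow 2).div_const 2)).congr_deriv
        (by rw [hode x hx]; push_cast; ring)) hω
    simp only [ofReal_neg, neg_add_cancel] at this
    linear_combination this
  refine ⟨ψ' (-ω₀), fun ω hω => ?_⟩
  have := eq_left_of_hasDerivWithinAt_zero
    (g := fun ω => ψ ω - (((ω : ℂ) + ω₀) ^ 3 / 6 + ψ' (-ω₀) * (ω + ω₀)))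
    (fun x hx => ((hψ x hx).sub ((((hshift x).pow 3).div_const 6).add
      ((hshift x).const_mul (ψ' (-ω₀))))).congr_deriv
      (by rw [hfirst x hx]; push_cast; ring)) hω
  simp only [ofReal_neg, neg_add_cancel, hleft] at this
  linear_combination this

/-- For `b = -2`, the pair `(φ⁽⁰⁾, φ⁽¹⁾)` with `φ⁽⁰⁾(ω) = ω + ω₀`, `φ⁽¹⁾ ≡ 0` is a Jordan
chain of length 2 at the eigenvalue `λ = 0`, and there is no second associated vector. -/
theorem statement12 (ω₀ : ℝ) (hω₀ : 0 < ω₀) (hω₀' : ω₀ < Real.pi) :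
    IsJordanChain2 ω₀ (-2) 0 (fun ω => (ω : ℂ) + (ω₀ : ℂ)) (fun _ => 0) ∧
    ¬ ∃ ψ : ℝ → ℂ, IsAssociatedSol ω₀ (-2) 0 (fun ω => (ω : ℂ) + (ω₀ : ℂ)) ψ := by
  refine ⟨⟨⟨⟨⟨fun _ => 1, fun _ => 0, ⟨fun ω _ => hasDerivWithinAt_ofReal_add_const _ _ ω,
    fun ω _ => hasDerivWithinAt_const ω _ 1, continuousOn_const⟩, ?_⟩, ?_, ?_⟩,
    0, ⟨by linarith, hω₀.le⟩, ?_⟩,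
    ⟨fun _ => 0, fun _ => 0, ⟨fun ω _ => hasDerivWithinAt_const ω _ 0,
      fun ω _ => hasDerivWithinAt_const ω _ 0, continuousOn_const⟩, ?_⟩, ?_, ?_⟩, ?_⟩
  · simp
  · simp
  · push_cast
    ring
  · simpa using hω₀.ne'
  · simp
  · rfl
  · simp
  · rintro ⟨ψ, ⟨ψ', ψ'', hC2, hode⟩, hleft, hright⟩
    obtain ⟨c, hc⟩ := hC2.exists_eq_cubic
      (fun ω hω => by linear_combination hode ω hω) hleft
    rw [hc ω₀ ⟨by linarith, le_rfl⟩, hc 0 ⟨by linarith, hω₀.le⟩] at hright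
    push_cast at hright
    have hcube : (ω₀ : ℂ) ^ 3 = 0 := by linear_combination hright
    exact hω₀.ne' (ofReal_eq_zero.mp (pow_eq_zero_iff three_ne_zero |>.mp hcube))
end
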